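/- Let $H_0$ and $H_0^{\zeta}$ be time-independent Hermitian $n\times n$ complex matrices, let $H_c : \mathbb{R} \to$ (Hermitian $n\times n$ complex matrices) be continuous, and set $H_{\mathcal E}(t) = H_0 + H_c(t)$ and $H_{\zeta}(t) = H_0^{\zeta} + H_c(t)$. Let $U_{\mathcal E}$ and $U_{\zeta}$ be the Schrödinger propagators generated by $H_{\mathcal E}$ and $H_{\zeta}$ respectively. Then for every $t > 0$, $\|U_{\mathcal E} - U_{\zeta}\|_{\infty,t} \le t^2\, \delta\, \big( \tfrac{1}{t} + \tfrac{2}{t}\|H_c\|_{1,t} + \|H_{\zeta}\|_{\infty,t} + \|H_{\mathcal E}\|_{\infty,t} \big)$, where $\delta = \|H_0^{\zeta} - H_0\|$. -/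

import Mathlib

open Matrix
noncomputable section
attribute [local instance] Matrix.normedAddCommGroup Matrix.normedSpace

/-- Spectral norm (largest singular value) of a complex matrix. -/
def specNorm {n : ℕ} (A : Matrix (Fin n) (Fin n) ℂ) : ℝ :=
  ‖Matrix.toEuclideanCLM (𝕜 := ℂ) A‖

/-- `U` is the Schrödinger propagator generated by `H`:
`dU/dt = -i H(t) U(t)`, `U(0) = 1` (units `ħ = 1`). -/
def IsPropagator {n : ℕ} (H U : ℝ → Matrix (Fin n) (Fin n) ℂ) : Prop :=
  U 0 = 1 ∧ ∀ t : ℝ, HasDerivAt U ((-Complex.I) • (H t * U t)) t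

/-- `‖A‖_{∞,t} = sup_{s ∈ [0,t]} ‖A(s)‖` (spectral norm). -/
def supNorm {n : ℕ} (A : ℝ → Matrix (Fin n) (Fin n) ℂ) (t : ℝ) : ℝ :=
  sSup ((fun s => specNorm (A s)) '' Set.Icc 0 t)

/-- `‖A‖_{1,t} = ∫_0^t ‖A(s)‖ ds` (spectral norm). -/
def l1Norm {n : ℕ} (A : ℝ → Matrix (Fin n) (Fin n) ℂ) (t : ℝ) : ℝ :=
  ∫ s in (0:ℝ)..t, specNorm (A s)


lemma specNorm_nonneg' {n : ℕ} (A : Matrix (Fin n) (Fin n) ℂ) : 0 ≤ specNorm A := norm_nonneg _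

lemma supNorm_nonneg' {n : ℕ} (A : ℝ → Matrix (Fin n) (Fin n) ℂ) (t : ℝ) : 0 ≤ supNorm A t := by
  apply Real.sSup_nonneg
  rintro _ ⟨s, _, rfl⟩
  exact norm_nonneg _

lemma prop_deriv {n : ℕ} {H U : ℝ → Matrix (Fin n) (Fin n) ℂ} (hU : IsPropagator H U) (s : ℝ) :
    HasDerivAt (fun s => Matrix.toEuclideanCLM (𝕜 := ℂ) (U s))
      ((-Complex.I) • (Matrix.toEuclideanCLM (𝕜 := ℂ) (H s) *
        Matrix.toEuclideanCLM (𝕜 := ℂ) (U s))) s := by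
  let L : Matrix (Fin n) (Fin n) ℂ →ₗ[ℝ]
      (EuclideanSpace ℂ (Fin n) →L[ℂ] EuclideanSpace ℂ (Fin n)) :=
    { toFun := fun A => Matrix.toEuclideanCLM (𝕜 := ℂ) A
      map_add' := fun A B => map_add _ A B
      map_smul' := fun r A => by
        have : (r • A) = ((r : ℂ) • A) := by ext i j; simp
        rw [this, map_smul]; ext; simp }
  have h := (LinearMap.toContinuousLinearMap L).hasFDerivAt.comp_hasDerivAt s (hU.2 s)
  have e : (LinearMap.toContinuousLinearMap L) ((-Complex.I) • (H s * U s)) =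
      ((-Complex.I) • (Matrix.toEuclideanCLM (𝕜 := ℂ) (H s) *
        Matrix.toEuclideanCLM (𝕜 := ℂ) (U s))) := by
    change Matrix.toEuclideanCLM (𝕜 := ℂ) ((-Complex.I) • (H s * U s)) = _
    rw [map_smul, map_mul]
  exact HasDerivAt.congr_deriv h e

lemma alg_aux {A : Type*} [Ring A] [Algebra ℂ A] (u h k v : A) :
    (Complex.I • (u * h)) * v + u * ((-Complex.I) • (k * v)) = Complex.I • (u * (h - k) * v) := by
  rw [smul_mul_assoc, mul_smul_comm, neg_smul, ← sub_eq_add_neg, ← smul_sub]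
  congr 1
  noncomm_ring

lemma prod_deriv {n : ℕ} {H K U V : ℝ → Matrix (Fin n) (Fin n) ℂ}
    (hU : IsPropagator H U) (hV : IsPropagator K V) (hH : ∀ s, (H s).IsHermitian) (s : ℝ) :
    HasDerivAt (fun s => star (Matrix.toEuclideanCLM (𝕜 := ℂ) (U s)) *
        Matrix.toEuclideanCLM (𝕜 := ℂ) (V s))
      (Complex.I • (star (Matrix.toEuclideanCLM (𝕜 := ℂ) (U s)) *
        Matrix.toEuclideanCLM (𝕜 := ℂ) (H s - K s) *
        Matrix.toEuclideanCLM (𝕜 := ℂ) (V s))) s := by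
  have h := (prop_deriv hU s).star.mul (prop_deriv hV s)
  have hs : star (Matrix.toEuclideanCLM (𝕜 := ℂ) (H s)) = Matrix.toEuclideanCLM (𝕜 := ℂ) (H s) := by
    rw [← map_star]; congr 1; exact hH s
  refine HasDerivAt.congr_deriv h ?_
  rw [star_smul, star_mul, hs, map_sub]
  have hi : star (-Complex.I) = Complex.I := by simp
  rw [hi]
  exact alg_aux _ _ _ _

lemma prop_unitary {n : ℕ} {H U : ℝ → Matrix (Fin n) (Fin n) ℂ}
    (hU : IsPropagator H U) (hH : ∀ s, (H s).IsHermitian) (s : ℝ) :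
    Matrix.toEuclideanCLM (𝕜 := ℂ) (U s) ∈
      unitary (EuclideanSpace ℂ (Fin n) →L[ℂ] EuclideanSpace ℂ (Fin n)) := by
  have hd := fun s => prod_deriv hU hU hH s
  have hc := is_const_of_deriv_eq_zero (fun s => (hd s).differentiableAt)
    (fun s => by rw [(hd s).deriv]; simp) s 0
  simp only [hU.1, map_one, star_one, mul_one] at hc
  refine Unitary.mem_iff.2 ⟨hc, ?_⟩
  rw [← map_star, ← map_mul, ← map_one (Matrix.toEuclideanCLM (𝕜 := ℂ) (n := Fin n))] at hc ⊢
  have h2 := (Matrix.toEuclideanCLM (𝕜 := ℂ) (n := Fin n)).injective hc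
  rw [mul_eq_one_comm.1 h2]

lemma norm_le_one_unitary {n : ℕ} {A : EuclideanSpace ℂ (Fin n) →L[ℂ] EuclideanSpace ℂ (Fin n)}
    (hA : A ∈ unitary (EuclideanSpace ℂ (Fin n) →L[ℂ] EuclideanSpace ℂ (Fin n))) : ‖A‖ ≤ 1 := by
  have h := CStarRing.norm_star_mul_self (x := A)
  rw [Unitary.star_mul_self_of_mem hA] at h
  have h1 : ‖(1 : EuclideanSpace ℂ (Fin n) →L[ℂ] EuclideanSpace ℂ (Fin n))‖ ≤ 1 :=
    ContinuousLinearMap.norm_id_le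
  nlinarith [norm_nonneg A]

lemma diff_bound {n : ℕ} {H K U V : ℝ → Matrix (Fin n) (Fin n) ℂ}
    (hU : IsPropagator H U) (hV : IsPropagator K V) (hH : ∀ s, (H s).IsHermitian)
    (hK : ∀ s, (K s).IsHermitian) (δ : ℝ) (hδ : ∀ s, specNorm (H s - K s) ≤ δ)
    (s : ℝ) (hs : 0 ≤ s) : specNorm (U s - V s) ≤ δ * s := by
  have hd := fun s => prod_deriv hU hV hH s
  have hb := Convex.norm_image_sub_le_of_norm_hasDerivWithin_le (C := δ) (s := Set.univ)
    (fun x _ => (hd x).hasDerivWithinAt) (fun x _ => by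
      rw [norm_smul, Complex.norm_I, one_mul]
      have h1 := norm_le_one_unitary (prop_unitary hU hH x)
      have h2 := norm_le_one_unitary (prop_unitary hV hK x)
      rw [← norm_star] at h1
      have h3 : ‖Matrix.toEuclideanCLM (𝕜 := ℂ) (H x - K x)‖ ≤ δ := hδ x
      have h0 : 0 ≤ δ := (norm_nonneg _).trans h3
      calc _ ≤ _ := norm_mul_le _ _
        _ ≤ (1 * δ) * 1 := by
          refine mul_le_mul ((norm_mul_le _ _).trans ?_) h2 (norm_nonneg _) (by linarith)
          exact mul_le_mul h1 h3 (norm_nonneg _) zero_le_one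
        _ = δ := by ring) convex_univ (Set.mem_univ 0) (Set.mem_univ s)
  simp only [hU.1, hV.1, map_one, star_one, mul_one, sub_zero, Real.norm_eq_abs,
    abs_of_nonneg hs] at hb
  have hu := prop_unitary hU hH s
  have e : Matrix.toEuclideanCLM (𝕜 := ℂ) (U s - V s) = -(Matrix.toEuclideanCLM (𝕜 := ℂ) (U s) *
      (star (Matrix.toEuclideanCLM (𝕜 := ℂ) (U s)) * Matrix.toEuclideanCLM (𝕜 := ℂ) (V s) - 1)) := by
    rw [mul_sub, ← mul_assoc, Unitary.mul_star_self_of_mem hu, map_sub]; simp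
  unfold specNorm
  rw [e, norm_neg]
  refine (norm_mul_le _ _).trans ?_
  have h1 := norm_le_one_unitary hu
  exact (mul_le_of_le_one_left (norm_nonneg _) h1).trans hb

/-- Bound on the unitary model prediction error in terms of the Hamiltonian error
`δ = ‖H₀ᶻ - H₀‖`. -/
theorem model_prediction_unitary_bound {n : ℕ}
    (H0 Hζ0 : Matrix (Fin n) (Fin n) ℂ)
    (hH0 : H0.IsHermitian) (hHζ0 : Hζ0.IsHermitian)
    (Hc : ℝ → Matrix (Fin n) (Fin n) ℂ)
    (hHcCont : Continuous Hc) (hHcHerm : ∀ t, (Hc t).IsHermitian)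
    (UE Uζ : ℝ → Matrix (Fin n) (Fin n) ℂ)
    (hUE : IsPropagator (fun t => H0 + Hc t) UE)
    (hUζ : IsPropagator (fun t => Hζ0 + Hc t) Uζ)
    (t : ℝ) (ht : 0 < t) :
    supNorm (fun s => UE s - Uζ s) t ≤
      t ^ 2 * specNorm (Hζ0 - H0) *
        (1 / t + (2 / t) * l1Norm Hc t
          + supNorm (fun s => Hζ0 + Hc s) t
          + supNorm (fun s => H0 + Hc s) t) := by
  have hδ0 := specNorm_nonneg' (Hζ0 - H0)
  have hl : 0 ≤ l1Norm Hc t := intervalIntegral.integral_nonneg ht.le fun _ _ => norm_nonneg _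
  have h1 := supNorm_nonneg' (fun s => Hζ0 + Hc s) t
  have h2 := supNorm_nonneg' (fun s => H0 + Hc s) t
  have key : supNorm (fun s => UE s - Uζ s) t ≤ specNorm (Hζ0 - H0) * t := by
    apply csSup_le ((Set.nonempty_Icc.2 ht.le).image _)
    rintro _ ⟨s, hs, rfl⟩
    refine (diff_bound hUE hUζ (fun s => hH0.add (hHcHerm s)) (fun s => hHζ0.add (hHcHerm s))
      (specNorm (Hζ0 - H0)) (fun s => ?_) s hs.1).trans (mul_le_mul_of_nonneg_left hs.2 hδ0)
    rw [add_sub_add_right_eq_sub]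
    unfold specNorm
    rw [map_sub, map_sub, norm_sub_rev]
  refine key.trans ?_
  have e : specNorm (Hζ0 - H0) * t = t ^ 2 * specNorm (Hζ0 - H0) * (1 / t) := by
    field_simp
  rw [e]
  refine mul_le_mul_of_nonneg_left ?_ (by positivity)
  have : 0 ≤ (2 / t) * l1Norm Hc t := by positivity
  linarith
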